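/- Let k ≥ 1 be an integer and let P ⊂ ℝ^n be a full-dimensional smooth lattice polytope such that every edge of P has lattice length exactly k. Then for any two vertices u, v of P the difference u − v lies in kℤ^n; consequently, if v_0 is a vertex of P, then (1/k)(P − v_0) is a smooth lattice polytope every edge of which has lattice length 1. -/

import Mathlib

open Set

/-- The real point corresponding to an integer lattice point. -/
def toR {n : ℕ} (v : Fin n → ℤ) : Fin n → ℝ := fun i => (v i : ℝ)

/-- `P` is a lattice polytope: the convex hull of a finite set of integer points. -/
def IsLatticePolytope {n : ℕ} (P : Set (Fin n → ℝ)) : Prop :=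
  ∃ S : Finset (Fin n → ℤ), P = convexHull ℝ (toR '' (S : Set (Fin n → ℤ)))

/-- `P` is full-dimensional: its affine span is everything. -/
def IsFullDim {n : ℕ} (P : Set (Fin n → ℝ)) : Prop :=
  affineSpan ℝ P = ⊤

/-- A vertex of `P` is an extreme point of `P`. -/
def IsVertex {n : ℕ} (P : Set (Fin n → ℝ)) (v : Fin n → ℝ) : Prop :=
  v ∈ Set.extremePoints ℝ P

/-- The segment from `a` to `b` (distinct integer points) is an edge of `P`,
i.e. an exposed face of `P` which is a segment. -/
def IsEdge {n : ℕ} (P : Set (Fin n → ℝ)) (a b : Fin n → ℤ) : Prop :=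
  a ≠ b ∧ IsExposed ℝ P (segment ℝ (toR a) (toR b))

/-- The lattice length of an integer vector: the gcd of its entries. -/
def latticeLength {n : ℕ} (v : Fin n → ℤ) : ℕ :=
  Finset.univ.gcd fun i => (v i).natAbs

/-- The primitive integer vector in the direction of `v`. -/
def primVec {n : ℕ} (v : Fin n → ℤ) : Fin n → ℤ :=
  fun i => v i / (latticeLength v : ℤ)

/-- `P` is smooth at the integer vertex `v`: there are exactly `n` edges through `v`
and the primitive directions of these edges form a `ℤ`-basis of `ℤⁿ`. -/
def SmoothAtVertex {n : ℕ} (P : Set (Fin n → ℝ)) (v : Fin n → ℤ) : Prop :=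
  ∃ b : Fin n → (Fin n → ℤ),
    Function.Injective b ∧
    (∀ i, IsEdge P v (b i)) ∧
    (∀ c : Fin n → ℤ, IsEdge P v c →
      ∃ i, segment ℝ (toR v) (toR c) = segment ℝ (toR v) (toR (b i))) ∧
    IsUnit (Matrix.det (Matrix.of fun i => primVec (b i - v)))

/-- `P` is a full-dimensional smooth lattice polytope. -/
def IsSmoothPolytope {n : ℕ} (P : Set (Fin n → ℝ)) : Prop :=
  IsLatticePolytope P ∧ IsFullDim P ∧
    ∀ v : Fin n → ℤ, IsVertex P (toR v) → SmoothAtVertex P v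

/-- Every edge of `P` has lattice length at least `k`. -/
def EdgesAtLeast {n : ℕ} (P : Set (Fin n → ℝ)) (k : ℕ) : Prop :=
  ∀ a b : Fin n → ℤ, IsEdge P a b → k ≤ latticeLength (b - a)

/-- `P` is a Cayley polytope of order `k` with altitude in direction `eᵢ`:
`P ⊆ {x : 0 ≤ xᵢ ≤ k}` and every vertex of `P` has `i`-th coordinate `0` or `k`. -/
def IsCayley {n : ℕ} (P : Set (Fin n → ℝ)) (k : ℕ) (i : Fin n) : Prop :=
  (∀ x ∈ P, 0 ≤ x i ∧ x i ≤ (k : ℝ)) ∧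
  (∀ v : Fin n → ℝ, IsVertex P v → v i = 0 ∨ v i = (k : ℝ))

/-- `P` is canonically positioned: `0` is a vertex and for each `i` there is an
edge of `P` contained in the nonnegative `xᵢ`-coordinate axis. -/
def CanonicallyPositioned {n : ℕ} (P : Set (Fin n → ℝ)) : Prop :=
  IsVertex P 0 ∧
  ∀ i : Fin n, ∃ a b : Fin n → ℤ, IsEdge P a b ∧
    segment ℝ (toR a) (toR b) ⊆ {x | 0 ≤ x i ∧ ∀ j, j ≠ i → x j = 0}

/-- `F` is a facet of `P`: an exposed face of dimension `n - 1`. -/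
def IsFacet {n : ℕ} (P F : Set (Fin n → ℝ)) : Prop :=
  IsExposed ℝ P F ∧ Module.finrank ℝ (affineSpan ℝ F).direction = n - 1

/-- The lattice width of `Q`: the minimum over nonzero integer functionals `φ` of
`max_{x ∈ Q} ⟨φ, x⟩ - min_{x ∈ Q} ⟨φ, x⟩`. -/
noncomputable def latticeWidth {n : ℕ} (Q : Set (Fin n → ℝ)) : ℝ :=
  ⨅ φ : {φ : Fin n → ℤ // φ ≠ 0},
    (sSup ((fun x => ∑ i, (φ.1 i : ℝ) * x i) '' Q) -
      sInf ((fun x => ∑ i, (φ.1 i : ℝ) * x i) '' Q))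

section Polytope

variable {E : Type*} [NormedAddCommGroup E] [NormedSpace ℝ E]

/-- The convex hull of finitely many points is the convex hull of its extreme points. -/
theorem convexHull_extremePoints_convexHull {S : Set E} (hS : S.Finite) :
    convexHull ℝ ((convexHull ℝ S).extremePoints ℝ) = convexHull ℝ S := by
  have hfin := hS.subset (extremePoints_convexHull_subset (𝕜 := ℝ) (A := S))
  rw [← (hfin.isClosed_convexHull (𝕜 := ℝ)).closure_eq]
  exact closure_convexHull_extremePoints (hS.isCompact_convexHull (𝕜 := ℝ))
    (convex_convexHull ℝ S)

/-- An extreme point of the hull of a finite set is strictly exposed among the generators. -/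
theorem exists_forall_lt_of_mem_extremePoints {S : Set E} (hS : S.Finite) {e : E}
    (he : e ∈ (convexHull ℝ S).extremePoints ℝ) :
    ∃ f : StrongDual ℝ E, ∀ s ∈ S, s ≠ e → f s < f e := by
  have hconv := ((convex_convexHull ℝ S).mem_extremePoints_iff_convex_sdiff.1 he).2
  have hsub : convexHull ℝ (S \ {e}) ⊆ convexHull ℝ S \ {e} :=
    convexHull_min (sdiff_subset_sdiff_left (subset_convexHull ℝ S)) hconv
  obtain ⟨f, u, hf, hu⟩ := geometric_hahn_banach_closed_point (convex_convexHull ℝ (S \ {e}))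
    ((hS.subset sdiff_subset).isClosed_convexHull (𝕜 := ℝ)) fun h => (hsub h).2 rfl
  exact ⟨f, fun s hs hne => (hf s (subset_convexHull ℝ _ ⟨hs, hne⟩)).trans hu⟩

/-- A linear functional that is positive somewhere on a compact convex set is positive at one of
its extreme points. -/
theorem exists_extremePoint_pos {Q : Set E} (hQ : IsCompact Q) (hc : Convex ℝ Q)
    (l : StrongDual ℝ E) {x : E} (hx : x ∈ Q) (hlx : 0 < l x) :
    ∃ e ∈ Q.extremePoints ℝ, 0 < l e := by
  by_contra! h
  have hsub : closure (convexHull ℝ (Q.extremePoints ℝ)) ⊆ {y | l y ≤ 0} :=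
    closure_minimal (convexHull_min h (convex_halfSpace_le l.toLinearMap.isLinear 0))
      (isClosed_le l.continuous continuous_const)
  rw [closure_convexHull_extremePoints hQ hc] at hsub
  exact (hsub hx).not_gt hlx

/-- The simplex step: a vertex of a polytope that does not maximize a linear functional has an
edge along which the functional increases. -/
theorem exists_exposed_segment_lt {S : Set E} (hS : S.Finite) {v : E}
    (hv : v ∈ (convexHull ℝ S).extremePoints ℝ) (l : StrongDual ℝ E) {s₀ : E} (hs₀ : s₀ ∈ S)
    (hl : l v < l s₀) :
    ∃ c ∈ S, IsExposed ℝ (convexHull ℝ S) (segment ℝ v c) ∧ l v < l c := by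
  obtain ⟨f, hf⟩ := exists_forall_lt_of_mem_extremePoints hS hv
  set m : E → ℝ := fun s => f v - f s with hm
  have hmpos : ∀ s ∈ S, s ≠ v → 0 < m s := fun s hs hne => sub_pos.2 (hf s hs hne)
  set p : E → E := fun s => (m s)⁻¹ • (s - v) with hp
  have hmp : ∀ s ∈ S, s ≠ v → m s • p s = s - v := fun s hs hne =>
    smul_inv_smul₀ (hmpos s hs hne).ne' _
  have hDfin : (p '' (S \ {v})).Finite := (hS.subset sdiff_subset).image p
  have hs₀v : s₀ ≠ v := by rintro rfl; exact lt_irrefl _ hl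
  obtain ⟨e, he, hle⟩ := exists_extremePoint_pos (hDfin.isCompact_convexHull (𝕜 := ℝ))
    (convex_convexHull ℝ _) l
    (subset_convexHull ℝ _ (mem_image_of_mem p (⟨hs₀, hs₀v⟩ : s₀ ∈ S \ {v})))
    (by
      simp only [hp, map_smul, map_sub, smul_eq_mul]
      exact mul_pos (inv_pos.2 (hmpos s₀ hs₀ hs₀v)) (sub_pos.2 hl))
  obtain ⟨h, hh⟩ := exists_forall_lt_of_mem_extremePoints hDfin he
  -- the generators on the ray from `v` in direction `e`; the farthest one ends the edge
  obtain ⟨c, ⟨⟨hcS, hcv⟩, hce⟩, hcmax⟩ := Set.exists_max_image {s ∈ S \ {v} | p s = e} m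
    (hS.subset fun s hs => hs.1.1) (by simpa [Set.Nonempty] using extremePoints_convexHull_subset he)
  have hcv' : c ≠ v := hcv
  have hmc := hmpos c hcS hcv'
  have hlc : l v < l c := by
    have := congrArg l (hmp c hcS hcv')
    rw [hce, map_smul, map_sub, smul_eq_mul] at this
    have := mul_pos hmc hle
    linarith
  set G : StrongDual ℝ E := h + (h e) • f with hG
  have hGs : ∀ s ∈ S, s ≠ v → G s - G v = m s * (h (p s) - h e) := by
    intro s hs hne
    have := congrArg h (hmp s hs hne)
    rw [map_smul, map_sub, smul_eq_mul] at this
    simp only [hG, add_apply, smul_apply, smul_eq_mul]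
    rw [mul_sub, this]
    simp only [hm]
    ring
  have hGle : ∀ s ∈ S, G s ≤ G v := by
    intro s hs
    by_cases hne : s = v
    · rw [hne]
    by_cases hpe : p s = e
    · have := hGs s hs hne
      rw [hpe, sub_self, mul_zero] at this
      linarith
    · have := hGs s hs hne
      have := mul_pos (hmpos s hs hne) (sub_pos.2 (hh _ (mem_image_of_mem p ⟨hs, hne⟩) hpe))
      nlinarith
  have hGP : ∀ x ∈ convexHull ℝ S, G x ≤ G v := fun x hx =>
    convexHull_min hGle (convex_halfSpace_le G.toLinearMap.isLinear (G v)) hx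
  have hGc : G c = G v := by
    have := hGs c hcS hcv'
    rw [hce, sub_self, mul_zero] at this
    linarith
  have hvP : v ∈ convexHull ℝ S := extremePoints_subset hv
  set F : Set E := {x ∈ convexHull ℝ S | ∀ y ∈ convexHull ℝ S, G y ≤ G x} with hF
  have hFexp : IsExposed ℝ (convexHull ℝ S) F := fun _ => ⟨G, rfl⟩
  have hvF : v ∈ F := ⟨hvP, hGP⟩
  have hcF : c ∈ F := ⟨subset_convexHull ℝ S hcS, fun y hy => hGc ▸ hGP y hy⟩
  have hFconv : Convex ℝ F := hFexp.convex (convex_convexHull ℝ S)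
  have hSF : ∀ s ∈ S, s ∈ F → s ∈ segment ℝ v c := by
    intro s hs hsF
    by_cases hne : s = v
    · rw [hne]; exact left_mem_segment ℝ v c
    have hpe : p s = e := by
      by_contra hpe
      have h1 := hGs s hs hne
      have h2 := mul_pos (hmpos s hs hne)
        (sub_pos.2 (hh _ (mem_image_of_mem p ⟨hs, hne⟩) hpe))
      have h3 := hsF.2 v hvP
      nlinarith
    rw [segment_eq_image']
    refine ⟨m s / m c, ⟨div_nonneg (hmpos s hs hne).le hmc.le,
      div_le_one_of_le₀ (hcmax s ⟨⟨hs, hne⟩, hpe⟩) hmc.le⟩, ?_⟩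
    have h1 := hmp s hs hne
    have h2 := hmp c hcS hcv'
    rw [hpe] at h1
    rw [hce] at h2
    simp only
    rw [← h2, smul_smul, div_mul_cancel₀ _ hmc.ne', h1, add_sub_cancel]
  have hFseg : F = segment ℝ v c := by
    refine Subset.antisymm ?_ (hFconv.segment_subset hvF hcF)
    have hFc : IsCompact F := hFexp.isCompact (hS.isCompact_convexHull (𝕜 := ℝ))
    rw [← closure_convexHull_extremePoints hFc hFconv]
    refine closure_minimal (convexHull_min ?_ (convex_segment v c)) ?_
    · intro x hx
      exact hSF x (extremePoints_convexHull_subset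
        (hFexp.isExtreme.extremePoints_subset_extremePoints hx)) hx.1
    · rw [← convexHull_pair]
      exact (Set.toFinite {v, c}).isClosed_convexHull (𝕜 := ℝ)
  exact ⟨c, hcS, hFseg ▸ hFexp, hlc⟩

theorem right_mem_extremePoints_segment {a b : E} (hab : a ≠ b) :
    b ∈ (segment ℝ a b).extremePoints ℝ := by
  by_contra hb
  have hK := convexHull_extremePoints_convexHull (Set.toFinite {a, b})
  have hsub : (segment ℝ a b).extremePoints ℝ ⊆ {a} := by
    intro x hx
    have hx' := hx
    rw [← convexHull_pair] at hx'
    rcases extremePoints_convexHull_subset hx' with h | h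
    · exact h
    · rw [mem_singleton_iff.1 h] at hx
      exact absurd hx hb
  rw [convexHull_pair] at hK
  have := convexHull_mono hsub (hK ▸ right_mem_segment ℝ a b)
  rw [convexHull_singleton] at this
  exact hab this.symm

variable {F : Type*} [NormedAddCommGroup F] [NormedSpace ℝ F]

theorem AffineEquiv.image_extremePoints (e : E ≃ᵃ[ℝ] F) (A : Set E) :
    e '' A.extremePoints ℝ = (e '' A).extremePoints ℝ := by
  have key : ∀ x, e x ∈ (e '' A).extremePoints ℝ ↔ x ∈ A.extremePoints ℝ := by
    intro x
    simp only [mem_extremePoints_iff_left, forall_mem_image, e.injective.mem_set_image,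
      e.injective.eq_iff]
    have hseg : ∀ y z, e x ∈ openSegment ℝ (e y) (e z) ↔ x ∈ openSegment ℝ y z := by
      intro y z
      have := image_openSegment ℝ e.toAffineMap y z
      rw [AffineEquiv.coe_toAffineMap] at this
      rw [← this, e.injective.mem_set_image]
    simp only [hseg]
  ext y
  obtain ⟨x, rfl⟩ := e.surjective y
  rw [e.injective.mem_set_image, key]

theorem IsExposed.image_affineEquiv [FiniteDimensional ℝ F] (e : E ≃ᵃ[ℝ] F) {A B : Set E}
    (h : IsExposed ℝ A B) : IsExposed ℝ (e '' A) (e '' B) := by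
  intro hne
  obtain ⟨l, hl⟩ := h hne.of_image
  refine ⟨LinearMap.toContinuousLinearMap (l.toLinearMap ∘ₗ e.symm.linear.toLinearMap), ?_⟩
  have key : ∀ x y : E, l (e.symm.linear (e x)) ≤ l (e.symm.linear (e y)) ↔ l x ≤ l y := by
    intro x y
    have h1 : e.symm.linear (e x) - e.symm.linear (e y) = x - y := by
      have := e.symm.toAffineMap.linearMap_vsub (e x) (e y)
      simpa using this
    have h2 := congrArg l h1
    rw [map_sub, map_sub] at h2
    constructor <;> intro <;> linarith
  ext y
  obtain ⟨x, rfl⟩ := e.surjective y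
  rw [e.injective.mem_set_image, hl]
  have hsymm : ∀ z, (e.linear.symm z : E) = e.symm.linear z := fun z => rfl
  simp [hsymm, key]

theorem AffineEquiv.isExposed_image_iff [FiniteDimensional ℝ E] [FiniteDimensional ℝ F]
    (e : E ≃ᵃ[ℝ] F) {A B : Set E} : IsExposed ℝ (e '' A) (e '' B) ↔ IsExposed ℝ A B := by
  refine ⟨fun h => ?_, fun h => h.image_affineEquiv e⟩
  have := h.image_affineEquiv e.symm
  simpa [image_image] using this

end Polytope

section Lattice

variable {n : ℕ}

theorem toR_injective : Function.Injective (toR (n := n)) := fun _ _ h =>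
  funext fun i => Int.cast_injective (congrFun h i)

theorem IsEdge.isVertex_right {P : Set (Fin n → ℝ)} {a b : Fin n → ℤ} (h : IsEdge P a b) :
    IsVertex P (toR b) :=
  h.2.isExtreme.extremePoints_subset_extremePoints
    (right_mem_extremePoints_segment (toR_injective.ne h.1))

theorem latticeLength_dvd (v : Fin n → ℤ) (i : Fin n) : (latticeLength v : ℤ) ∣ v i :=
  Int.natCast_dvd.2 (Finset.gcd_dvd (Finset.mem_univ i))

theorem latticeLength_smul (k : ℕ) (v : Fin n → ℤ) :
    latticeLength ((k : ℤ) • v) = k * latticeLength v := by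
  simp [latticeLength, Int.natAbs_mul, Finset.gcd_mul_left]

theorem primVec_smul {k : ℕ} (hk : k ≠ 0) (v : Fin n → ℤ) :
    primVec ((k : ℤ) • v) = primVec v := by
  funext i
  simp only [primVec, latticeLength_smul, Pi.smul_apply, smul_eq_mul, Nat.cast_mul]
  exact Int.mul_ediv_mul_of_pos _ _ (by omega)

theorem IsLatticePolytope.dvd_sub_of_isVertex {k : ℕ} {P : Set (Fin n → ℝ)}
    (hP : IsLatticePolytope P)
    (hEdge : ∀ a b : Fin n → ℤ, IsEdge P a b → (k : ℤ) ∣ latticeLength (b - a))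
    {u v : Fin n → ℤ} (hu : IsVertex P (toR u)) (hv : IsVertex P (toR v)) (i : Fin n) :
    (k : ℤ) ∣ u i - v i := by
  obtain ⟨S, rfl⟩ := hP
  have hS : (toR '' (S : Set (Fin n → ℤ))).Finite := S.finite_toSet.image _
  obtain ⟨f, hf⟩ := exists_forall_lt_of_mem_extremePoints hS hv
  have hmem : ∀ {w : Fin n → ℤ},
      IsVertex (convexHull ℝ (toR '' (S : Set (Fin n → ℤ)))) (toR w) → w ∈ S := fun hw => by
    simpa [toR_injective.mem_set_image] using extremePoints_convexHull_subset hw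
  obtain ⟨w, ⟨hw, hwu⟩, hmax⟩ := Set.exists_max_image
    {w | IsVertex (convexHull ℝ (toR '' (S : Set (Fin n → ℤ)))) (toR w) ∧
      ∀ i, (k : ℤ) ∣ u i - w i} (fun w => f (toR w))
    (S.finite_toSet.subset fun w hw => hmem hw.1) ⟨u, hu, by simp⟩
  suffices w = v by rw [← this]; exact hwu i
  by_contra hne
  have hlt := hf _ (mem_image_of_mem toR (hmem hw)) (toR_injective.ne hne)
  obtain ⟨_, ⟨c, -, rfl⟩, hexp, hwc⟩ := exists_exposed_segment_lt hS hw f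
    (mem_image_of_mem toR (hmem hv)) hlt
  have hedge : IsEdge (convexHull ℝ (toR '' (S : Set (Fin n → ℤ)))) w c :=
    ⟨by rintro rfl; exact lt_irrefl _ hwc, hexp⟩
  refine (hmax c ⟨hedge.isVertex_right, fun j => ?_⟩).not_gt hwc
  have h1 : (k : ℤ) ∣ c j - w j := (hEdge w c hedge).trans (latticeLength_dvd (c - w) j)
  have h2 := dvd_sub (hwu j) h1
  rwa [show u j - w j - (c j - w j) = u j - c j by ring] at h2

variable {e : (Fin n → ℝ) ≃ᵃ[ℝ] (Fin n → ℝ)} {φ : (Fin n → ℤ) → (Fin n → ℤ)}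

theorem isVertex_image_iff (hφ : ∀ a, e (toR (φ a)) = toR a) {P : Set (Fin n → ℝ)}
    {a : Fin n → ℤ} : IsVertex (e '' P) (toR a) ↔ IsVertex P (toR (φ a)) := by
  rw [IsVertex, IsVertex, ← e.image_extremePoints, ← hφ a, e.injective.mem_set_image]

theorem isEdge_image_iff (hφ : ∀ a, e (toR (φ a)) = toR a) {P : Set (Fin n → ℝ)}
    {a b : Fin n → ℤ} : IsEdge (e '' P) a b ↔ IsEdge P (φ a) (φ b) := by
  have hinj : Function.Injective φ := fun x y h =>
    toR_injective (by rw [← hφ x, ← hφ y, h])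
  have hseg := image_segment ℝ e.toAffineMap (toR (φ a)) (toR (φ b))
  simp only [AffineEquiv.coe_toAffineMap, hφ] at hseg
  rw [IsEdge, IsEdge, hinj.ne_iff, ← hseg, e.isExposed_image_iff]

theorem IsLatticePolytope.image_affineEquiv (hφ : ∀ a, e (toR (φ a)) = toR a)
    {P : Set (Fin n → ℝ)} (hP : IsLatticePolytope P)
    (hrange : ∀ v, IsVertex P (toR v) → v ∈ range φ) : IsLatticePolytope (e '' P) := by
  obtain ⟨S, rfl⟩ := hP
  have hS : (toR '' (S : Set (Fin n → ℤ))).Finite := S.finite_toSet.image _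
  set X := (convexHull ℝ (toR '' (S : Set (Fin n → ℤ)))).extremePoints ℝ with hX
  have hfin : (e '' X).Finite := (hS.subset extremePoints_convexHull_subset).image e
  have hsub : e '' X ⊆ range toR := by
    rintro _ ⟨x, hx, rfl⟩
    obtain ⟨s, -, rfl⟩ := extremePoints_convexHull_subset hx
    obtain ⟨a, rfl⟩ := hrange s hx
    exact ⟨a, (hφ a).symm⟩
  refine ⟨(hfin.preimage toR_injective.injOn).toFinset, ?_⟩
  rw [Finite.coe_toFinset, image_preimage_eq_of_subset hsub,
    ← convexHull_extremePoints_convexHull hS, ← hX]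
  exact e.toAffineMap.image_convexHull X

/-- Smoothness passes to the rescaled lattice `φ(ℤⁿ)`, provided it contains all vertices. -/
theorem IsSmoothPolytope.image_affineEquiv (hφ : ∀ a, e (toR (φ a)) = toR a) {k : ℕ}
    (hk : k ≠ 0) (hφsub : ∀ a b, φ b - φ a = (k : ℤ) • (b - a)) {P : Set (Fin n → ℝ)}
    (hP : IsSmoothPolytope P) (hrange : ∀ v, IsVertex P (toR v) → v ∈ range φ) :
    IsSmoothPolytope (e '' P) := by
  refine ⟨hP.1.image_affineEquiv hφ hrange, e.span_eq_top_iff.1 hP.2.1, fun w hw => ?_⟩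
  obtain ⟨b, hinj, hedge, hall, hdet⟩ := hP.2.2 (φ w) ((isVertex_image_iff hφ).1 hw)
  choose b' hb' using fun i => hrange (b i) (hedge i).isVertex_right
  have hseg : ∀ x y, e '' segment ℝ (toR (φ x)) (toR (φ y)) = segment ℝ (toR x) (toR y) := by
    intro x y
    have := image_segment ℝ e.toAffineMap (toR (φ x)) (toR (φ y))
    simpa only [AffineEquiv.coe_toAffineMap, hφ] using this
  refine ⟨b', fun i j h => hinj (by rw [← hb' i, ← hb' j, h]), fun i => ?_, fun c hc => ?_, ?_⟩
  · rw [isEdge_image_iff hφ, hb']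
    exact hedge i
  · obtain ⟨i, hi⟩ := hall (φ c) ((isEdge_image_iff hφ).1 hc)
    refine ⟨i, ?_⟩
    rw [← hseg w c, ← hseg w (b' i), hi, hb']
  · have : ∀ i, primVec (b' i - w) = primVec (b i - φ w) := fun i => by
      rw [← hb' i, hφsub, primVec_smul hk]
    simpa only [this] using hdet

end Lattice


/-- If every edge of a full-dimensional smooth lattice polytope `P` has
lattice length exactly `k ≥ 1`, then the difference of any two vertices lies in `kℤⁿ`;
consequently, for any vertex `v₀`, the polytope `(1/k)(P - v₀)` is a smooth lattice
polytope all of whose edges have lattice length `1`. -/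
theorem stmt_1 {n k : ℕ} (hk : 1 ≤ k) (P : Set (Fin n → ℝ))
    (hP : IsSmoothPolytope P)
    (hEdge : ∀ a b : Fin n → ℤ, IsEdge P a b → latticeLength (b - a) = k) :
    (∀ u v : Fin n → ℤ, IsVertex P (toR u) → IsVertex P (toR v) →
      ∀ i, (k : ℤ) ∣ (u i - v i)) ∧
    ∀ v₀ : Fin n → ℤ, IsVertex P (toR v₀) →
      IsSmoothPolytope ((fun x => (k : ℝ)⁻¹ • (x - toR v₀)) '' P) ∧
      ∀ a b : Fin n → ℤ, IsEdge ((fun x => (k : ℝ)⁻¹ • (x - toR v₀)) '' P) a b →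
        latticeLength (b - a) = 1 := by
  have hdvd : ∀ u v : Fin n → ℤ, IsVertex P (toR u) → IsVertex P (toR v) →
      ∀ i, (k : ℤ) ∣ (u i - v i) := fun u v hu hv =>
    hP.1.dvd_sub_of_isVertex (fun a b h => by rw [hEdge a b h]) hu hv
  refine ⟨hdvd, fun v₀ hv₀ => ?_⟩
  have hk0 : k ≠ 0 := by omega
  have hkR : (k : ℝ) ≠ 0 := by exact_mod_cast hk0
  let e : (Fin n → ℝ) ≃ᵃ[ℝ] (Fin n → ℝ) :=
    (AffineEquiv.constVAdd ℝ (Fin n → ℝ) (-toR v₀)).trans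
      (LinearEquiv.smulOfNeZero ℝ (Fin n → ℝ) (k : ℝ)⁻¹ (inv_ne_zero hkR)).toAffineEquiv
  have he : (fun x => (k : ℝ)⁻¹ • (x - toR v₀)) = e := by
    funext x
    simp [e, sub_eq_neg_add]
  let φ : (Fin n → ℤ) → (Fin n → ℤ) := fun a => (k : ℤ) • a + v₀
  have hφ : ∀ a, e (toR (φ a)) = toR a := by
    intro a
    rw [← he]
    funext i
    simp [φ, toR, hkR]
  have hφsub : ∀ a b, φ b - φ a = (k : ℤ) • (b - a) := fun a b => by
    simp only [φ, add_sub_add_right_eq_sub, smul_sub]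
  have hrange : ∀ v, IsVertex P (toR v) → v ∈ range φ := by
    intro v hv
    choose a ha using hdvd v v₀ hv hv₀
    refine ⟨a, funext fun i => ?_⟩
    simp only [φ, Pi.add_apply, Pi.smul_apply, smul_eq_mul, ← ha i, sub_add_cancel]
  rw [he]
  refine ⟨hP.image_affineEquiv hφ hk0 hφsub hrange, fun a b hab => ?_⟩
  have h := hEdge _ _ ((isEdge_image_iff hφ).1 hab)
  rw [hφsub, latticeLength_smul] at h
  exact Nat.eq_of_mul_eq_mul_left (Nat.pos_of_ne_zero hk0) (h.trans (mul_one k).symm)
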